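/- arXiv:1808.05415 — 6 statements merged into one kernel-verified Lean document; each statement's English description precedes it below -/
import Mathlib

section
/- The category Petri of Petri nets and Petri net morphisms has all small colimits. -/
universe u

open CategoryTheory

structure PetriNet : Type (u + 1) where
  T : Type u
  S : Type u
  src : T → Multiset S
  tgt : T → Multiset S

/-- A morphism of Petri nets. -/
structure PetriHom (P Q : PetriNet.{u}) where
  f : P.T → Q.T
  g : P.S → Q.S
  hs : ∀ τ : P.T, (P.src τ).map g = Q.src (f τ)
  ht : ∀ τ : P.T, (P.tgt τ).map g = Q.tgt (f τ)

/-- The category `Petri` of Petri nets and Petri net morphisms, with composition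
`(f, g) ∘ (f', g') = (f ∘ f', g ∘ g')`. -/
instance : Category PetriNet.{u} where
  Hom := PetriHom
  id P := ⟨_root_.id, _root_.id, fun τ => by simp, fun τ => by simp⟩
  comp φ ψ := ⟨ψ.f ∘ φ.f, ψ.g ∘ φ.g,
    fun τ => by rw [← Multiset.map_map, φ.hs, ψ.hs]; rfl,
    fun τ => by rw [← Multiset.map_map, φ.ht, ψ.ht]; rfl⟩
  id_comp φ := rfl
  comp_id φ := rfl
  assoc φ ψ χ := rfl

namespace PetriNet

@[ext]
lemma hom_ext {P Q : PetriNet.{u}} {φ ψ : P ⟶ Q} (hf : PetriHom.f φ = PetriHom.f ψ)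
    (hg : PetriHom.g φ = PetriHom.g ψ) : φ = ψ := by
  obtain ⟨f, g, _, _⟩ := φ
  obtain ⟨f', g', _, _⟩ := ψ
  obtain rfl : f = f' := hf
  obtain rfl : g = g' := hg
  rfl

/-- The functor sending a Petri net to its type of transitions. -/
def transitions : PetriNet.{u} ⥤ Type u where
  obj P := P.T
  map φ := ↾(PetriHom.f φ)

/-- The functor sending a Petri net to its type of places. -/
def places : PetriNet.{u} ⥤ Type u where
  obj P := P.S
  map φ := ↾(PetriHom.g φ)

variable {J : Type u} [Category.{u} J] (F : J ⥤ PetriNet.{u})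

lemma ι_places_comp {j j' : J} (f : j ⟶ j') :
    (F ⋙ places).ιColimitType j' ∘ PetriHom.g (F.map f) = (F ⋙ places).ιColimitType j :=
  funext fun s => (F ⋙ places).ιColimitType_map f s

/-- The sources of the transitions in a diagram of Petri nets, as multisets of places of the
colimit. -/
def srcCocone : (F ⋙ transitions).CoconeTypes where
  pt := Multiset (F ⋙ places).ColimitType
  ι j τ := ((F.obj j).src τ).map ((F ⋙ places).ιColimitType j)
  ι_naturality {j j'} f := funext fun τ =>
    (congrArg (Multiset.map ((F ⋙ places).ιColimitType j')) (PetriHom.hs (F.map f) τ)).symm.trans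
      ((Multiset.map_map _ _ _).trans
        (congrArg (fun h => ((F.obj j).src τ).map h) (ι_places_comp F f)))

/-- The targets of the transitions in a diagram of Petri nets, as multisets of places of the
colimit. -/
def tgtCocone : (F ⋙ transitions).CoconeTypes where
  pt := Multiset (F ⋙ places).ColimitType
  ι j τ := ((F.obj j).tgt τ).map ((F ⋙ places).ιColimitType j)
  ι_naturality {j j'} f := funext fun τ =>
    (congrArg (Multiset.map ((F ⋙ places).ιColimitType j')) (PetriHom.ht (F.map f) τ)).symm.trans
      ((Multiset.map_map _ _ _).trans
        (congrArg (fun h => ((F.obj j).tgt τ).map h) (ι_places_comp F f)))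

/-- The colimit of a diagram of Petri nets: transitions and places are the colimits of the
transitions and of the places. -/
def colimitNet : PetriNet.{u} where
  T := (F ⋙ transitions).ColimitType
  S := (F ⋙ places).ColimitType
  src := (F ⋙ transitions).descColimitType (srcCocone F)
  tgt := (F ⋙ transitions).descColimitType (tgtCocone F)

/-- The canonical cocone with point `colimitNet F`. -/
def colimitCocone : Limits.Cocone F where
  pt := colimitNet F
  ι :=
    { app j :=
        { f := (F ⋙ transitions).ιColimitType j
          g := (F ⋙ places).ιColimitType j
          hs _ := rfl
          ht _ := rfl }
      naturality _ _ f := hom_ext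
        (funext fun τ => (F ⋙ transitions).ιColimitType_map f τ)
        (ι_places_comp F f) }

variable {F}

/-- The cocone on transitions underlying a cocone of Petri nets. -/
def transitionsCocone (c : Limits.Cocone F) : (F ⋙ transitions).CoconeTypes where
  pt := c.pt.T
  ι j := PetriHom.f (c.ι.app j)
  ι_naturality f := congrArg PetriHom.f (c.w f)

/-- The cocone on places underlying a cocone of Petri nets. -/
def placesCocone (c : Limits.Cocone F) : (F ⋙ places).CoconeTypes where
  pt := c.pt.S
  ι j := PetriHom.g (c.ι.app j)
  ι_naturality f := congrArg PetriHom.g (c.w f)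

/-- The morphism from `colimitNet F` induced by a cocone. -/
def colimitDesc (c : Limits.Cocone F) : PetriHom (colimitNet F) c.pt where
  f := (F ⋙ transitions).descColimitType (transitionsCocone c)
  g := (F ⋙ places).descColimitType (placesCocone c)
  hs τ := by
    obtain ⟨j, τ, rfl⟩ := (F ⋙ transitions).ιColimitType_jointly_surjective τ
    exact (Multiset.map_map _ _ _).trans (PetriHom.hs (c.ι.app j) τ)
  ht τ := by
    obtain ⟨j, τ, rfl⟩ := (F ⋙ transitions).ιColimitType_jointly_surjective τ
    exact (Multiset.map_map _ _ _).trans (PetriHom.ht (c.ι.app j) τ)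

variable (F) in
/-- `colimitCocone F` is a colimit cocone. -/
def colimitCoconeIsColimit : Limits.IsColimit (colimitCocone F) where
  desc c := colimitDesc c
  fac _ _ := rfl
  uniq c m hm := by
    refine hom_ext (funext fun τ => ?_) (funext fun s => ?_)
    · obtain ⟨j, τ, rfl⟩ := (F ⋙ transitions).ιColimitType_jointly_surjective τ
      exact congrFun (congrArg PetriHom.f (hm j)) τ
    · obtain ⟨j, s, rfl⟩ := (F ⋙ places).ιColimitType_jointly_surjective s
      exact congrFun (congrArg PetriHom.g (hm j)) s

end PetriNet

/-- The category `Petri` of Petri nets and Petri net morphisms has all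
small colimits. -/
theorem petri_hasColimits : Limits.HasColimits PetriNet.{u} := by
  exact ⟨fun _ _ => ⟨fun F => ⟨⟨PetriNet.colimitCocone F, PetriNet.colimitCoconeIsColimit F⟩⟩⟩⟩
end

section
/- The functor F : Petri → CMC, sending each Petri net P to the free commutative monoidal category FP and each Petri net morphism (f, g) : P → P' to the strict monoidal functor F(f, g) : FP → FP' that acts as ℕ[g] on objects and is the unique extension of f on generating morphisms preserving identities, composition and the tensor product, admits a right adjoint; that is, F is a left adjoint functor. -/
universe u

open CategoryTheory

/-- A commutative monoidal category: a commutative monoid object internal to `Cat`.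
Explicitly, a strict monoidal category whose objects form a commutative monoid (written
additively) and whose tensor product `+` of morphisms is strictly associative, unital and
commutative; the laws whose two sides have only propositionally equal (endpoint) types are
stated with `HEq`. -/
structure CMC : Type (u + 1) where
  Obj : Type u
  [objMon : AddCommMonoid Obj]
  Hom : Obj → Obj → Type u
  id : ∀ a : Obj, Hom a a
  comp : ∀ {a b c : Obj}, Hom a b → Hom b c → Hom a c
  add : ∀ {a b a' b' : Obj}, Hom a b → Hom a' b' → Hom (a + a') (b + b')
  id_comp : ∀ {a b : Obj} (f : Hom a b), comp (id a) f = f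
  comp_id : ∀ {a b : Obj} (f : Hom a b), comp f (id b) = f
  assoc : ∀ {a b c d : Obj} (f : Hom a b) (g : Hom b c) (h : Hom c d),
    comp (comp f g) h = comp f (comp g h)
  add_id : ∀ a b : Obj, add (id a) (id b) = id (a + b)
  interchange : ∀ {a₁ b₁ c₁ a₂ b₂ c₂ : Obj} (f₁ : Hom a₁ b₁) (g₁ : Hom b₁ c₁)
    (f₂ : Hom a₂ b₂) (g₂ : Hom b₂ c₂),
    add (comp f₁ g₁) (comp f₂ g₂) = comp (add f₁ f₂) (add g₁ g₂)
  add_assoc : ∀ {a₁ b₁ a₂ b₂ a₃ b₃ : Obj} (f₁ : Hom a₁ b₁) (f₂ : Hom a₂ b₂)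
    (f₃ : Hom a₃ b₃), HEq (add (add f₁ f₂) f₃) (add f₁ (add f₂ f₃))
  add_comm : ∀ {a₁ b₁ a₂ b₂ : Obj} (f₁ : Hom a₁ b₁) (f₂ : Hom a₂ b₂),
    HEq (add f₁ f₂) (add f₂ f₁)
  add_zero : ∀ {a b : Obj} (f : Hom a b), HEq (add f (id 0)) f

attribute [instance] CMC.objMon

/-- A strict monoidal functor between commutative monoidal categories: a monoid
homomorphism on objects together with a map on morphisms strictly preserving identities,
composition and the tensor product `+`. -/
structure CMCHom (C D : CMC.{u}) where
  f₀ : C.Obj →+ D.Obj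
  f₁ : ∀ (a b : C.Obj), C.Hom a b → D.Hom (f₀ a) (f₀ b)
  map_id : ∀ a : C.Obj, f₁ a a (C.id a) = D.id (f₀ a)
  map_comp : ∀ {a b c : C.Obj} (f : C.Hom a b) (g : C.Hom b c),
    f₁ a c (C.comp f g) = D.comp (f₁ a b f) (f₁ b c g)
  map_add : ∀ {a b a' b' : C.Obj} (f : C.Hom a b) (g : C.Hom a' b'),
    HEq (f₁ (a + a') (b + b') (C.add f g)) (D.add (f₁ a b f) (f₁ a' b' g))

theorem CMCHom.f₁_hcongr {C D : CMC.{u}} (F : CMCHom C D) {a b a' b' : C.Obj}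
    (h1 : a = a') (h2 : b = b') {u : C.Hom a b} {v : C.Hom a' b'} (h : HEq u v) :
    HEq (F.f₁ a b u) (F.f₁ a' b' v) := by
  subst h1; subst h2; rw [eq_of_heq h]

/-- The category `CMC` of commutative monoidal categories and strict monoidal functors. -/
instance : Category CMC.{u} where
  Hom := CMCHom
  id C :=
    { f₀ := AddMonoidHom.id C.Obj
      f₁ := fun _ _ f => f
      map_id := fun _ => rfl
      map_comp := fun _ _ => rfl
      map_add := fun _ _ => HEq.rfl }
  comp {C D E} F G :=
    { f₀ := G.f₀.comp F.f₀
      f₁ := fun a b f => G.f₁ _ _ (F.f₁ a b f)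
      map_id := fun a => by
        show G.f₁ _ _ (F.f₁ a a (C.id a)) = _
        rw [F.map_id, G.map_id]; rfl
      map_comp := fun f g => by
        show G.f₁ _ _ (F.f₁ _ _ (C.comp f g)) = _
        rw [F.map_comp, G.map_comp]
      map_add := fun {a b a' b'} f g => by
        refine HEq.trans (G.f₁_hcongr ?_ ?_ (F.map_add f g)) (G.map_add _ _)
        · exact map_add F.f₀ a a'
        · exact map_add F.f₀ b b' }
  id_comp F := rfl
  comp_id F := rfl
  assoc F G H := rfl



/-- Formal morphism expressions of the free commutative monoidal category `FP` on a Petri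
net `P`: generated by a morphism `τ : s(τ) → t(τ)` for each transition, identities, sums
and composites. -/
inductive FreeExpr (P : PetriNet.{u}) : Multiset P.S → Multiset P.S → Type u
  | gen (τ : P.T) : FreeExpr P (P.src τ) (P.tgt τ)
  | id (a : Multiset P.S) : FreeExpr P a a
  | comp {a b c : Multiset P.S} : FreeExpr P a b → FreeExpr P b c → FreeExpr P a c
  | add {a b a' b' : Multiset P.S} :
      FreeExpr P a b → FreeExpr P a' b' → FreeExpr P (a + a') (b + b')

/-- The congruence on morphism expressions imposing the laws of a commutative monoidal
category: category laws, functoriality of `+`, and the commutative monoid laws for `+`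
on morphisms (stated heterogeneously since the endpoints are only propositionally
equal). -/
inductive FreeRel (P : PetriNet.{u}) :
    ∀ {a b a' b' : Multiset P.S}, FreeExpr P a b → FreeExpr P a' b' → Prop
  | refl {a b} (f : FreeExpr P a b) : FreeRel P f f
  | symm {a b a' b'} {f : FreeExpr P a b} {g : FreeExpr P a' b'} :
      FreeRel P f g → FreeRel P g f
  | trans {a b a' b' a'' b''} {f : FreeExpr P a b} {g : FreeExpr P a' b'}
      {h : FreeExpr P a'' b''} : FreeRel P f g → FreeRel P g h → FreeRel P f h
  | comp_congr {a b c a' b' c'} {f : FreeExpr P a b} {g : FreeExpr P b c}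
      {f' : FreeExpr P a' b'} {g' : FreeExpr P b' c'} :
      FreeRel P f f' → FreeRel P g g' → FreeRel P (f.comp g) (f'.comp g')
  | add_congr {a₁ b₁ a₂ b₂ a₁' b₁' a₂' b₂'} {f : FreeExpr P a₁ b₁} {g : FreeExpr P a₂ b₂}
      {f' : FreeExpr P a₁' b₁'} {g' : FreeExpr P a₂' b₂'} :
      FreeRel P f f' → FreeRel P g g' → FreeRel P (f.add g) (f'.add g')
  | id_comp {a b} (f : FreeExpr P a b) : FreeRel P ((FreeExpr.id a).comp f) f
  | comp_id {a b} (f : FreeExpr P a b) : FreeRel P (f.comp (FreeExpr.id b)) f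
  | assoc {a b c d} (f : FreeExpr P a b) (g : FreeExpr P b c) (h : FreeExpr P c d) :
      FreeRel P ((f.comp g).comp h) (f.comp (g.comp h))
  | add_id (a b : Multiset P.S) :
      FreeRel P ((FreeExpr.id a).add (FreeExpr.id b)) (FreeExpr.id (a + b))
  | interchange {a₁ b₁ c₁ a₂ b₂ c₂} (f₁ : FreeExpr P a₁ b₁) (g₁ : FreeExpr P b₁ c₁)
      (f₂ : FreeExpr P a₂ b₂) (g₂ : FreeExpr P b₂ c₂) :
      FreeRel P ((f₁.comp g₁).add (f₂.comp g₂)) ((f₁.add f₂).comp (g₁.add g₂))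
  | add_assoc {a₁ b₁ a₂ b₂ a₃ b₃} (f₁ : FreeExpr P a₁ b₁) (f₂ : FreeExpr P a₂ b₂)
      (f₃ : FreeExpr P a₃ b₃) : FreeRel P ((f₁.add f₂).add f₃) (f₁.add (f₂.add f₃))
  | add_comm {a₁ b₁ a₂ b₂} (f₁ : FreeExpr P a₁ b₁) (f₂ : FreeExpr P a₂ b₂) :
      FreeRel P (f₁.add f₂) (f₂.add f₁)
  | add_zero {a b} (f : FreeExpr P a b) : FreeRel P (f.add (FreeExpr.id 0)) f

/-- The hom-sets of the free commutative monoidal category `FP` on the Petri net `P`: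
morphism expressions modulo the laws of a commutative monoidal category.  The objects of
`FP` form the free commutative monoid `ℕ[S] = Multiset P.S`. -/
def FreeHom (P : PetriNet.{u}) (a b : Multiset P.S) : Type u :=
  Quot (fun f g : FreeExpr P a b => FreeRel P f g)

/-- The identity morphism `1_a` in `FP`. -/
def FreeHom.id (P : PetriNet.{u}) (a : Multiset P.S) : FreeHom P a a :=
  Quot.mk _ (FreeExpr.id a)

/-- The generating morphism `τ : s(τ) → t(τ)` in `FP`. -/
def FreeHom.gen (P : PetriNet.{u}) (τ : P.T) : FreeHom P (P.src τ) (P.tgt τ) :=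
  Quot.mk _ (FreeExpr.gen τ)

/-- Composition in `FP`. -/
def FreeHom.comp {P : PetriNet.{u}} {a b c : Multiset P.S} :
    FreeHom P a b → FreeHom P b c → FreeHom P a c :=
  Quot.lift
    (fun f => Quot.lift (fun g => Quot.mk _ (f.comp g))
      (fun _ _ h => Quot.sound (FreeRel.comp_congr (FreeRel.refl f) h)))
    (fun f f' h => by
      funext x
      induction x using Quot.ind with
      | _ g => exact Quot.sound (FreeRel.comp_congr h (FreeRel.refl g)))

/-- The tensor product (sum) of morphisms in `FP`. -/
def FreeHom.add {P : PetriNet.{u}} {a b a' b' : Multiset P.S} :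
    FreeHom P a b → FreeHom P a' b' → FreeHom P (a + a') (b + b') :=
  Quot.lift
    (fun f => Quot.lift (fun g => Quot.mk _ (f.add g))
      (fun _ _ h => Quot.sound (FreeRel.add_congr (FreeRel.refl f) h)))
    (fun f f' h => by
      funext x
      induction x using Quot.ind with
      | _ g => exact Quot.sound (FreeRel.add_congr h (FreeRel.refl g)))

/-- Transport a morphism expression along equalities of its endpoints. -/
def FreeExpr.castE {P : PetriNet.{u}} {a b a' b' : Multiset P.S}
    (h1 : a = a') (h2 : b = b') (e : FreeExpr P a b) : FreeExpr P a' b' := by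
  subst h1; subst h2; exact e

theorem FreeRel.cast_left {P : PetriNet.{u}} {a b a' b' : Multiset P.S}
    (h1 : a = a') (h2 : b = b') (e : FreeExpr P a b) :
    FreeRel P (e.castE h1 h2) e := by
  subst h1; subst h2; exact FreeRel.refl e

theorem FreeRel.cast_right {P : PetriNet.{u}} {a b a' b' : Multiset P.S}
    (h1 : a = a') (h2 : b = b') (e : FreeExpr P a b) :
    FreeRel P e (e.castE h1 h2) :=
  (FreeRel.cast_left h1 h2 e).symm

theorem FreeRel.id_congr {P : PetriNet.{u}} {a a' : Multiset P.S} (h : a = a') :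
    FreeRel P (FreeExpr.id a) (FreeExpr.id a') := by
  subst h; exact FreeRel.refl _

theorem FreeHom.heq_mk {P : PetriNet.{u}} {a b a' b' : Multiset P.S}
    (h1 : a = a') (h2 : b = b') {f : FreeExpr P a b} {g : FreeExpr P a' b'}
    (h : FreeRel P f g) :
    HEq (Quot.mk _ f : FreeHom P a b) (Quot.mk _ g : FreeHom P a' b') := by
  subst h1; subst h2; exact heq_of_eq (Quot.sound h)

/-- The free commutative monoidal category `FP` on a Petri net `P`. -/
def FreeCMC (P : PetriNet.{u}) : CMC.{u} where
  Obj := Multiset P.S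
  Hom := FreeHom P
  id := FreeHom.id P
  comp := FreeHom.comp
  add := FreeHom.add
  id_comp := fun f => by
    induction f using Quot.ind with
    | _ f => exact Quot.sound (FreeRel.id_comp f)
  comp_id := fun f => by
    induction f using Quot.ind with
    | _ f => exact Quot.sound (FreeRel.comp_id f)
  assoc := fun f g h => by
    induction f using Quot.ind with
    | _ f =>
    induction g using Quot.ind with
    | _ g =>
    induction h using Quot.ind with
    | _ h => exact Quot.sound (FreeRel.assoc f g h)
  add_id := fun a b => Quot.sound (FreeRel.add_id a b)
  interchange := fun f₁ g₁ f₂ g₂ => by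
    induction f₁ using Quot.ind with
    | _ f₁ =>
    induction g₁ using Quot.ind with
    | _ g₁ =>
    induction f₂ using Quot.ind with
    | _ f₂ =>
    induction g₂ using Quot.ind with
    | _ g₂ => exact Quot.sound (FreeRel.interchange f₁ g₁ f₂ g₂)
  add_assoc := fun f₁ f₂ f₃ => by
    induction f₁ using Quot.ind with
    | _ f₁ =>
    induction f₂ using Quot.ind with
    | _ f₂ =>
    induction f₃ using Quot.ind with
    | _ f₃ =>
      exact FreeHom.heq_mk (_root_.add_assoc _ _ _) (_root_.add_assoc _ _ _)
        (FreeRel.add_assoc f₁ f₂ f₃)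
  add_comm := fun f₁ f₂ => by
    induction f₁ using Quot.ind with
    | _ f₁ =>
    induction f₂ using Quot.ind with
    | _ f₂ =>
      exact FreeHom.heq_mk (_root_.add_comm _ _) (_root_.add_comm _ _)
        (FreeRel.add_comm f₁ f₂)
  add_zero := fun f => by
    induction f using Quot.ind with
    | _ f =>
      exact FreeHom.heq_mk (_root_.add_zero _) (_root_.add_zero _) (FreeRel.add_zero f)

/-- The action of a Petri net morphism on morphism expressions. -/
def FreeExpr.mapE {P Q : PetriNet.{u}} (φ : P ⟶ Q) :
    ∀ {a b : Multiset P.S}, FreeExpr P a b → FreeExpr Q (a.map φ.g) (b.map φ.g)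
  | _, _, .gen τ => FreeExpr.castE (φ.hs τ).symm (φ.ht τ).symm (.gen (φ.f τ))
  | _, _, .id a => .id (a.map φ.g)
  | _, _, .comp f g => .comp (mapE φ f) (mapE φ g)
  | _, _, .add f g =>
      FreeExpr.castE (Multiset.map_add φ.g _ _).symm (Multiset.map_add φ.g _ _).symm
        ((mapE φ f).add (mapE φ g))

theorem FreeRel.mapE_rel {P Q : PetriNet.{u}} (φ : P ⟶ Q)
    {a b a' b' : Multiset P.S} {e : FreeExpr P a b} {e' : FreeExpr P a' b'}
    (h : FreeRel P e e') : FreeRel Q (e.mapE φ) (e'.mapE φ) := by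
  induction h with
  | refl f => exact .refl _
  | symm _ ih => exact ih.symm
  | trans _ _ ih1 ih2 => exact ih1.trans ih2
  | comp_congr _ _ ih1 ih2 => exact .comp_congr ih1 ih2
  | add_congr _ _ ih1 ih2 =>
      exact ((FreeRel.cast_left _ _ _).trans (.add_congr ih1 ih2)).trans
        (FreeRel.cast_right _ _ _)
  | id_comp f => exact .id_comp _
  | comp_id f => exact .comp_id _
  | assoc f g h => exact .assoc _ _ _
  | add_id a b =>
      exact (FreeRel.cast_left _ _ _).trans
        ((FreeRel.add_id _ _).trans (FreeRel.id_congr (Multiset.map_add φ.g a b).symm))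
  | interchange f₁ g₁ f₂ g₂ =>
      exact (FreeRel.cast_left _ _ _).trans
        ((FreeRel.interchange _ _ _ _).trans
          (.comp_congr (FreeRel.cast_right _ _ _) (FreeRel.cast_right _ _ _)))
  | add_assoc f₁ f₂ f₃ =>
      refine (FreeRel.cast_left _ _ _).trans (FreeRel.trans ?_ (FreeRel.cast_right _ _ _))
      refine FreeRel.trans (.add_congr (FreeRel.cast_left _ _ _) (.refl _)) ?_
      refine (FreeRel.add_assoc _ _ _).trans ?_
      exact .add_congr (.refl _) (FreeRel.cast_right _ _ _)
  | add_comm f₁ f₂ =>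
      exact (FreeRel.cast_left _ _ _).trans
        ((FreeRel.add_comm _ _).trans (FreeRel.cast_right _ _ _))
  | add_zero f =>
      refine (FreeRel.cast_left _ _ _).trans ?_
      refine FreeRel.trans (.add_congr (.refl _) (FreeRel.id_congr (Multiset.map_zero φ.g))) ?_
      exact FreeRel.add_zero _

theorem CMCHom.ext' {C D : CMC.{u}} {F G : CMCHom C D} (h0 : F.f₀ = G.f₀)
    (h1 : ∀ (a b : C.Obj) (f : C.Hom a b), HEq (F.f₁ a b f) (G.f₁ a b f)) : F = G := by
  cases F with | mk F0 F1 Fi Fc Fa =>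
  cases G with | mk G0 G1 Gi Gc Ga =>
  dsimp only at h0 h1
  subst h0
  have h : F1 = G1 := by
    funext a b f
    exact eq_of_heq (h1 a b f)
  subst h
  rfl

theorem FreeRel.mapE_id {P : PetriNet.{u}} {a b : Multiset P.S} (e : FreeExpr P a b) :
    FreeRel P (e.mapE (𝟙 P)) e := by
  induction e with
  | gen τ => exact FreeRel.cast_left _ _ _
  | id a => exact FreeRel.id_congr (Multiset.map_id a)
  | comp f g ihf ihg => exact .comp_congr ihf ihg
  | add f g ihf ihg => exact (FreeRel.cast_left _ _ _).trans (.add_congr ihf ihg)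

theorem FreeRel.mapE_cast {P Q : PetriNet.{u}} (φ : P ⟶ Q) {a b a' b' : Multiset P.S}
    (h1 : a = a') (h2 : b = b') (e : FreeExpr P a b) :
    FreeRel Q ((FreeExpr.castE h1 h2 e).mapE φ) (e.mapE φ) := by
  subst h1; subst h2; exact .refl _

theorem FreeRel.mapE_comp {P Q R : PetriNet.{u}} (φ : P ⟶ Q) (ψ : Q ⟶ R)
    {a b : Multiset P.S} (e : FreeExpr P a b) :
    FreeRel R (e.mapE (φ ≫ ψ)) ((e.mapE φ).mapE ψ) := by
  induction e with
  | gen τ =>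
      refine (FreeRel.cast_left _ _ _).trans
        (FreeRel.trans ?_ (FreeRel.mapE_cast ψ _ _ _).symm)
      exact FreeRel.cast_right _ _ _
  | id a => exact FreeRel.id_congr (Multiset.map_map ψ.g φ.g a).symm
  | comp f g ihf ihg => exact .comp_congr ihf ihg
  | add f g ihf ihg =>
      refine (FreeRel.cast_left _ _ _).trans
        (FreeRel.trans ?_ (FreeRel.mapE_cast ψ _ _ _).symm)
      exact (FreeRel.add_congr ihf ihg).trans (FreeRel.cast_right _ _ _)

/-- The functor `F : Petri → CMC` sending a Petri net `P` to the free commutative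
monoidal category `FP` on it, acting on objects by `ℕ[g]` and on morphisms by the unique
extension of `f` preserving identities, composition and the tensor product. -/
def FreeFunctor : PetriNet.{u} ⥤ CMC.{u} where
  obj := FreeCMC
  map {P Q} φ :=
    { f₀ := Multiset.mapAddMonoidHom φ.g
      f₁ := fun a b => Quot.lift (fun e => Quot.mk _ (e.mapE φ))
          (fun _ _ h => Quot.sound (FreeRel.mapE_rel φ h))
      map_id := fun a => rfl
      map_comp := fun f g => by
        induction f using Quot.ind with
        | _ f =>
        induction g using Quot.ind with
        | _ g => rfl
      map_add := fun f g => by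
        induction f using Quot.ind with
        | _ f =>
        induction g using Quot.ind with
        | _ g =>
          exact FreeHom.heq_mk (Multiset.map_add φ.g _ _) (Multiset.map_add φ.g _ _)
            (FreeRel.cast_left _ _ _) }
  map_id P := CMCHom.ext' (AddMonoidHom.ext fun m => Multiset.map_id m)
    (fun a b f => by
      induction f using Quot.ind with
      | _ e =>
        exact FreeHom.heq_mk (Multiset.map_id a) (Multiset.map_id b) (FreeRel.mapE_id e))
  map_comp {P Q R} φ ψ := CMCHom.ext'
    (AddMonoidHom.ext fun m => (Multiset.map_map ψ.g φ.g m).symm)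
    (fun a b f => by
      induction f using Quot.ind with
      | _ e =>
        exact FreeHom.heq_mk (Multiset.map_map ψ.g φ.g a).symm
          (Multiset.map_map ψ.g φ.g b).symm (FreeRel.mapE_comp φ ψ e))

/-- Transport a morphism along equalities of its endpoints. -/
def CMC.castHom {C : CMC.{u}} {a b a' b' : C.Obj} (h1 : a = a') (h2 : b = b')
    (f : C.Hom a b) : C.Hom a' b' :=
  h1 ▸ h2 ▸ f

theorem CMC.castHom_heq {C : CMC.{u}} {a b a' b' : C.Obj} (h1 : a = a') (h2 : b = b')
    (f : C.Hom a b) : HEq (C.castHom h1 h2 f) f := by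
  subst h1; subst h2; rfl

theorem CMC.id_hcongr (C : CMC.{u}) {a a' : C.Obj} (h : a = a') :
    HEq (C.id a) (C.id a') := by
  subst h; rfl

theorem CMC.comp_hcongr (C : CMC.{u}) {a b c a' b' c' : C.Obj} (h1 : a = a') (h2 : b = b')
    (h3 : c = c') {f : C.Hom a b} {f' : C.Hom a' b'} {g : C.Hom b c} {g' : C.Hom b' c'}
    (hf : HEq f f') (hg : HEq g g') : HEq (C.comp f g) (C.comp f' g') := by
  subst h1; subst h2; subst h3; cases hf; cases hg; rfl

theorem CMC.add_hcongr (C : CMC.{u}) {a b c d a' b' c' d' : C.Obj} (h1 : a = a')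
    (h2 : b = b') (h3 : c = c') (h4 : d = d') {f : C.Hom a b} {f' : C.Hom a' b'}
    {g : C.Hom c d} {g' : C.Hom c' d'} (hf : HEq f f') (hg : HEq g g') :
    HEq (C.add f g) (C.add f' g') := by
  subst h1; subst h2; subst h3; subst h4; cases hf; cases hg; rfl

theorem FreeRel.endpoints {P : PetriNet.{u}} {a b a' b' : Multiset P.S}
    {e : FreeExpr P a b} {e' : FreeExpr P a' b'} (h : FreeRel P e e') :
    a = a' ∧ b = b' := by
  induction h with
  | refl => exact ⟨rfl, rfl⟩
  | symm _ ih => exact ⟨ih.1.symm, ih.2.symm⟩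
  | trans _ _ ih1 ih2 => exact ⟨ih1.1.trans ih2.1, ih1.2.trans ih2.2⟩
  | comp_congr _ _ ih1 ih2 => exact ⟨ih1.1, ih2.2⟩
  | add_congr _ _ ih1 ih2 =>
      exact ⟨congrArg₂ (· + ·) ih1.1 ih2.1, congrArg₂ (· + ·) ih1.2 ih2.2⟩
  | id_comp => exact ⟨rfl, rfl⟩
  | comp_id => exact ⟨rfl, rfl⟩
  | assoc => exact ⟨rfl, rfl⟩
  | add_id => exact ⟨rfl, rfl⟩
  | interchange => exact ⟨rfl, rfl⟩
  | add_assoc => exact ⟨_root_.add_assoc _ _ _, _root_.add_assoc _ _ _⟩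
  | add_comm => exact ⟨_root_.add_comm _ _, _root_.add_comm _ _⟩
  | add_zero => exact ⟨_root_.add_zero _, _root_.add_zero _⟩

theorem PetriHom.ext' {P Q : PetriNet.{u}} {φ ψ : PetriHom P Q}
    (hf : ∀ τ, φ.f τ = ψ.f τ) (hg : ∀ s, φ.g s = ψ.g s) : φ = ψ := by
  cases φ; cases ψ
  obtain rfl := funext hf
  obtain rfl := funext hg
  rfl

/-- A transition of the Petri net underlying a commutative monoidal category: a pair of
formal sums of objects together with a morphism between the actual sums. -/
structure CMC.Transition (C : CMC.{u}) : Type u where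
  src : Multiset C.Obj
  tgt : Multiset C.Obj
  hom : C.Hom src.sum tgt.sum

theorem CMC.Transition.ext' {C : CMC.{u}} {t t' : C.Transition} (h1 : t.src = t'.src)
    (h2 : t.tgt = t'.tgt) (h : HEq t.hom t'.hom) : t = t' := by
  cases t; cases t'
  dsimp only at h1 h2
  subst h1; subst h2; cases h; rfl

theorem CMC.Transition.hom_hcongr {C : CMC.{u}} {t t' : C.Transition} (h : t = t') :
    HEq t.hom t'.hom := by
  subst h; rfl

/-- The Petri net underlying a commutative monoidal category. -/
def CMC.toPetriNet (C : CMC.{u}) : PetriNet.{u} where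
  T := C.Transition
  S := C.Obj
  src := CMC.Transition.src
  tgt := CMC.Transition.tgt

section Lift

variable {P : PetriNet.{u}} {C : CMC.{u}} (φ : PetriHom P C.toPetriNet)

/-- The extension to `ℕ[S]` of the action on places. -/
def PetriHom.liftObj : Multiset P.S →+ C.Obj :=
  (Multiset.sumAddMonoidHom (M := C.Obj)).comp (Multiset.mapAddMonoidHom φ.g)

/-- The interpretation of formal morphism expressions in a commutative monoidal
category. -/
def PetriHom.liftExpr : ∀ {a b : Multiset P.S}, FreeExpr P a b →
    C.Hom (φ.liftObj a) (φ.liftObj b)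
  | _, _, .gen τ =>
      C.castHom (congrArg Multiset.sum (φ.hs τ).symm) (congrArg Multiset.sum (φ.ht τ).symm)
        (φ.f τ).hom
  | _, _, .id a => C.id _
  | _, _, .comp f g => C.comp (liftExpr f) (liftExpr g)
  | _, _, .add f g =>
      C.castHom (map_add φ.liftObj _ _).symm (map_add φ.liftObj _ _).symm
        (C.add (liftExpr f) (liftExpr g))

theorem PetriHom.liftExpr_add {a b a' b' : Multiset P.S} (f : FreeExpr P a b)
    (g : FreeExpr P a' b') :
    HEq (φ.liftExpr (f.add g)) (C.add (φ.liftExpr f) (φ.liftExpr g)) :=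
  CMC.castHom_heq _ _ _

theorem PetriHom.liftExpr_rel {a b a' b' : Multiset P.S} {e : FreeExpr P a b}
    {e' : FreeExpr P a' b'} (h : FreeRel P e e') : HEq (φ.liftExpr e) (φ.liftExpr e') := by
  have ho {x y : Multiset P.S} (h : x = y) : φ.liftObj x = φ.liftObj y := congrArg _ h
  induction h with
  | refl f => rfl
  | symm _ ih => exact ih.symm
  | trans _ _ ih1 ih2 => exact ih1.trans ih2
  | comp_congr h1 h2 ih1 ih2 =>
      exact C.comp_hcongr (ho h1.endpoints.1) (ho h1.endpoints.2) (ho h2.endpoints.2) ih1 ih2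
  | add_congr h1 h2 ih1 ih2 =>
      exact (φ.liftExpr_add _ _).trans ((C.add_hcongr (ho h1.endpoints.1) (ho h1.endpoints.2)
        (ho h2.endpoints.1) (ho h2.endpoints.2) ih1 ih2).trans (φ.liftExpr_add _ _).symm)
  | id_comp f => exact heq_of_eq (C.id_comp _)
  | comp_id f => exact heq_of_eq (C.comp_id _)
  | assoc f g h => exact heq_of_eq (C.assoc _ _ _)
  | add_id a b =>
      exact (φ.liftExpr_add _ _).trans
        ((heq_of_eq (C.add_id _ _)).trans (C.id_hcongr (map_add φ.liftObj a b).symm))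
  | interchange f₁ g₁ f₂ g₂ =>
      exact (φ.liftExpr_add _ _).trans ((heq_of_eq (C.interchange _ _ _ _)).trans
        (C.comp_hcongr (map_add φ.liftObj _ _).symm (map_add φ.liftObj _ _).symm
          (map_add φ.liftObj _ _).symm (φ.liftExpr_add _ _).symm (φ.liftExpr_add _ _).symm))
  | add_assoc f₁ f₂ f₃ =>
      refine (φ.liftExpr_add _ _).trans (HEq.trans ?_ (φ.liftExpr_add _ _).symm)
      exact (C.add_hcongr (map_add φ.liftObj _ _) (map_add φ.liftObj _ _) rfl rfl
        (φ.liftExpr_add _ _) HEq.rfl).trans ((C.add_assoc _ _ _).trans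
        (C.add_hcongr rfl rfl (map_add φ.liftObj _ _).symm (map_add φ.liftObj _ _).symm
          HEq.rfl (φ.liftExpr_add _ _).symm))
  | add_comm f₁ f₂ =>
      exact (φ.liftExpr_add _ _).trans ((C.add_comm _ _).trans (φ.liftExpr_add _ _).symm)
  | add_zero f =>
      exact (φ.liftExpr_add _ _).trans ((C.add_hcongr rfl rfl (map_zero φ.liftObj)
        (map_zero φ.liftObj) HEq.rfl (C.id_hcongr (map_zero φ.liftObj))).trans
        (C.add_zero _))

/-- The strict monoidal functor out of `FP` extending a morphism of Petri nets. -/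
def PetriHom.lift : CMCHom (FreeCMC P) C where
  f₀ := φ.liftObj
  f₁ _ _ := Quot.lift φ.liftExpr fun _ _ h => eq_of_heq (φ.liftExpr_rel h)
  map_id _ := rfl
  map_comp f g := by
    induction f using Quot.ind with
    | _ f =>
    induction g using Quot.ind with
    | _ g => rfl
  map_add f g := by
    induction f using Quot.ind with
    | _ f =>
    induction g using Quot.ind with
    | _ g => exact φ.liftExpr_add f g

end Lift

section Restrict

variable {P : PetriNet.{u}} {C : CMC.{u}}

theorem CMCHom.sum_map_singleton (G : CMCHom (FreeCMC P) C) (m : Multiset P.S) :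
    (m.map fun s => G.f₀ ({s} : Multiset P.S)).sum = G.f₀ m := by
  induction m using Multiset.induction with
  | empty => exact (_root_.map_zero G.f₀).symm
  | cons s m ih =>
    rw [Multiset.map_cons, Multiset.sum_cons, ih]
    exact (_root_.map_add G.f₀ ({s} : Multiset P.S) m).symm

/-- The restriction of a strict monoidal functor out of `FP` to the generators. -/
def CMCHom.restrict (G : CMCHom (FreeCMC P) C) : PetriHom P C.toPetriNet where
  f τ :=
    { src := (P.src τ).map fun s => G.f₀ ({s} : Multiset P.S)
      tgt := (P.tgt τ).map fun s => G.f₀ ({s} : Multiset P.S)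
      hom := C.castHom (G.sum_map_singleton _).symm (G.sum_map_singleton _).symm
        (G.f₁ _ _ (FreeHom.gen P τ)) }
  g s := G.f₀ ({s} : Multiset P.S)
  hs _ := rfl
  ht _ := rfl

theorem CMCHom.lift_restrict (G : CMCHom (FreeCMC P) C) : G.restrict.lift = G := by
  have h0 (m : Multiset P.S) : G.restrict.liftObj m = G.f₀ m := G.sum_map_singleton m
  refine CMCHom.ext' (AddMonoidHom.ext h0) fun a b f => ?_
  induction f using Quot.ind with
  | _ e =>
    change HEq (G.restrict.liftExpr e) (G.f₁ _ _ (Quot.mk _ e))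
    induction e with
    | gen τ => exact (CMC.castHom_heq _ _ _).trans (CMC.castHom_heq _ _ _)
    | id a => exact (C.id_hcongr (h0 a)).trans (heq_of_eq (G.map_id a).symm)
    | comp f g ihf ihg =>
      exact (C.comp_hcongr (h0 _) (h0 _) (h0 _) ihf ihg).trans
        (heq_of_eq (G.map_comp (Quot.mk _ f) (Quot.mk _ g)).symm)
    | add f g ihf ihg =>
      exact (G.restrict.liftExpr_add f g).trans
        ((C.add_hcongr (h0 _) (h0 _) (h0 _) (h0 _) ihf ihg).trans
          (G.map_add (Quot.mk _ f) (Quot.mk _ g)).symm)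

theorem PetriHom.restrict_lift (φ : PetriHom P C.toPetriNet) : φ.lift.restrict = φ := by
  have hg (s : P.S) : φ.lift.restrict.g s = φ.g s := Multiset.sum_singleton (M := C.Obj) (φ.g s)
  have hm (m : Multiset P.S) : m.map φ.lift.restrict.g = m.map φ.g :=
    Multiset.map_congr rfl fun s _ => hg s
  refine PetriHom.ext' (fun τ => ?_) hg
  exact CMC.Transition.ext' ((hm _).trans (φ.hs τ)) ((hm _).trans (φ.ht τ))
    ((CMC.castHom_heq _ _ _).trans (CMC.castHom_heq _ _ _))

/-- The universal property of the free commutative monoidal category. -/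
def FreeCMC.homEquiv (P : PetriNet.{u}) (C : CMC.{u}) :
    (FreeFunctor.obj P ⟶ C) ≃ (P ⟶ C.toPetriNet) where
  toFun := CMCHom.restrict
  invFun := PetriHom.lift
  left_inv := CMCHom.lift_restrict
  right_inv := PetriHom.restrict_lift

theorem FreeCMC.homEquiv_naturality_left {P Q : PetriNet.{u}} {C : CMC.{u}} (φ : P ⟶ Q)
    (G : FreeFunctor.obj Q ⟶ C) :
    FreeCMC.homEquiv P C (FreeFunctor.map φ ≫ G) = φ ≫ FreeCMC.homEquiv Q C G := by
  have hg (s : P.S) : (FreeCMC.homEquiv P C (FreeFunctor.map φ ≫ G)).g s =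
      (CMCHom.restrict G).g (φ.g s) := rfl
  refine PetriHom.ext' (fun τ => CMC.Transition.ext' ?_ ?_ ?_) hg
  · exact (Multiset.map_map (CMCHom.restrict G).g φ.g _).symm.trans
      (congrArg (Multiset.map (CMCHom.restrict G).g) (φ.hs τ))
  · exact (Multiset.map_map (CMCHom.restrict G).g φ.g _).symm.trans
      (congrArg (Multiset.map (CMCHom.restrict G).g) (φ.ht τ))
  · refine (CMC.castHom_heq _ _ _).trans (HEq.trans ?_ (CMC.castHom_heq _ _ _).symm)
    exact CMCHom.f₁_hcongr G (φ.hs τ) (φ.ht τ)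
      (FreeHom.heq_mk (φ.hs τ) (φ.ht τ) (FreeRel.cast_left _ _ _))

end Restrict

/-- The functor `F : Petri → CMC`, sending each Petri net to the free
commutative monoidal category on it, admits a right adjoint; that is, `F` is a left
adjoint functor. -/
theorem freeFunctor_isLeftAdjoint : FreeFunctor.{u}.IsLeftAdjoint := by
  exact ⟨_, ⟨Adjunction.adjunctionOfEquivRight FreeCMC.homEquiv
    fun _ _ _ φ G => FreeCMC.homEquiv_naturality_left φ G⟩⟩
end

section
/- The category CMC of commutative monoidal categories and strict monoidal functors has all small colimits; in particular it has all finite colimits. -/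
universe u

open CategoryTheory

namespace CMC

theorem comp_hcongr_s3 (D : CMC.{u}) {a b c a' b' c' : D.Obj} (ha : a = a') (hb : b = b')
    (hc : c = c') {f : D.Hom a b} {g : D.Hom b c} {f' : D.Hom a' b'} {g' : D.Hom b' c'}
    (hf : HEq f f') (hg : HEq g g') : HEq (D.comp f g) (D.comp f' g') := by
  subst ha hb hc; rw [eq_of_heq hf, eq_of_heq hg]

theorem add_hcongr_s3 (D : CMC.{u}) {a b c d a' b' c' d' : D.Obj} (ha : a = a') (hb : b = b')
    (hc : c = c') (hd : d = d') {f : D.Hom a b} {g : D.Hom c d} {f' : D.Hom a' b'}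
    {g' : D.Hom c' d'} (hf : HEq f f') (hg : HEq g g') : HEq (D.add f g) (D.add f' g') := by
  subst ha hb hc hd; rw [eq_of_heq hf, eq_of_heq hg]

theorem id_hcongr_s3 (D : CMC.{u}) {a a' : D.Obj} (ha : a = a') : HEq (D.id a) (D.id a') := by
  subst ha; rfl

end CMC

theorem CMCHom.ext_hom {C D : CMC.{u}} {F G : CMCHom C D} (h₀ : F.f₀ = G.f₀)
    (h₁ : ∀ a b (f : C.Hom a b), HEq (F.f₁ a b f) (G.f₁ a b f)) : F = G := by
  obtain ⟨F₀, F₁, _, _, _⟩ := F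
  obtain ⟨G₀, G₁, _, _, _⟩ := G
  obtain rfl : F₀ = G₀ := h₀
  obtain rfl : F₁ = G₁ := by
    funext a b f
    exact eq_of_heq (h₁ a b f)
  rfl

theorem CMCHom.congr_f₁ {C D : CMC.{u}} {F G : CMCHom C D} (h : F = G) {a b : C.Obj}
    (f : C.Hom a b) : HEq (F.f₁ a b f) (G.f₁ a b f) := by
  subst h; rfl

theorem CMCHom.congr_f₀ {C D : CMC.{u}} {F G : CMCHom C D} (h : F = G) (a : C.Obj) :
    F.f₀ a = G.f₀ a := by
  subst h; rfl

namespace CMC.Colimit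

variable {J : Type u} [Category.{u} J] (F : J ⥤ CMC.{u})

/-- The map on objects induced by a morphism of the diagram. -/
abbrev mapObj {j k : J} (u : j ⟶ k) : (F.obj j).Obj →+ (F.obj k).Obj := CMCHom.f₀ (F.map u)

/-- The map on morphisms induced by a morphism of the diagram. -/
abbrev mapHom {j k : J} (u : j ⟶ k) {a b : (F.obj j).Obj} (f : (F.obj j).Hom a b) :
    (F.obj k).Hom (mapObj F u a) (mapObj F u b) := CMCHom.f₁ (F.map u) a b f

/-- The relations presenting the commutative monoid of objects of the colimit. -/
inductive ObjRel : Multiset (Σ j, (F.obj j).Obj) → Multiset (Σ j, (F.obj j).Obj) → Prop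
  | zero (j : J) : ObjRel {⟨j, 0⟩} 0
  | add (j : J) (a b : (F.obj j).Obj) : ObjRel {⟨j, a + b⟩} ({⟨j, a⟩} + {⟨j, b⟩})
  | map {j k : J} (u : j ⟶ k) (a : (F.obj j).Obj) : ObjRel {⟨k, mapObj F u a⟩} {⟨j, a⟩}

/-- The commutative monoid of objects of the colimit. -/
abbrev Ob : Type u := (addConGen (ObjRel F)).Quotient

/-- The inclusion of the objects of a member of the diagram. -/
def ιObj (j : J) : (F.obj j).Obj →+ Ob F where
  toFun a := (({⟨j, a⟩} : Multiset (Σ j, (F.obj j).Obj)) : Ob F)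
  map_zero' := (AddCon.eq _).2 (.of _ _ (.zero j))
  map_add' a b := (AddCon.eq _).2 (.of _ _ (.add j a b))

theorem ιObj_map {j k : J} (u : j ⟶ k) (a : (F.obj j).Obj) :
    ιObj F k (mapObj F u a) = ιObj F j a :=
  (AddCon.eq _).2 (.of _ _ (.map u a))

variable {F} in
theorem obj_hom_ext {M : Type u} [AddCommMonoid M] {φ ψ : Ob F →+ M}
    (h : ∀ j a, φ (ιObj F j a) = ψ (ιObj F j a)) : φ = ψ := by
  refine AddCon.hom_ext (Multiset.addHom_ext fun x => ?_)
  exact h x.1 x.2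

/-- The universal property of the commutative monoid of objects. -/
def descObj {M : Type u} [AddCommMonoid M] (φ : ∀ j, (F.obj j).Obj →+ M)
    (hφ : ∀ {j k : J} (u : j ⟶ k) (a : (F.obj j).Obj), φ k (mapObj F u a) = φ j a) :
    Ob F →+ M :=
  (addConGen (ObjRel F)).lift
    (Multiset.sumAddMonoidHom.comp (Multiset.mapAddMonoidHom fun x => φ x.1 x.2)) <| by
    refine AddCon.addConGen_le.2 fun x y h => ?_
    cases h <;> simp [AddCon.ker_rel, hφ]

theorem descObj_ι {M : Type u} [AddCommMonoid M] (φ : ∀ j, (F.obj j).Obj →+ M)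
    (hφ : ∀ {j k : J} (u : j ⟶ k) (a : (F.obj j).Obj), φ k (mapObj F u a) = φ j a)
    (j : J) (a : (F.obj j).Obj) : descObj F φ hφ (ιObj F j a) = φ j a :=
  Multiset.sum_singleton _

/-- Formal expressions for the morphisms of the colimit. -/
inductive Pre : Ob F → Ob F → Type u
  | of (j : J) {a b : (F.obj j).Obj} (f : (F.obj j).Hom a b) : Pre (ιObj F j a) (ιObj F j b)
  | id (a : Ob F) : Pre a a
  | comp {a b c : Ob F} (f : Pre a b) (g : Pre b c) : Pre a c
  | add {a b a' b' : Ob F} (f : Pre a b) (g : Pre a' b') : Pre (a + a') (b + b')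

/-- The relations between formal expressions for the morphisms of the colimit, allowing
propositionally equal endpoints. -/
inductive Rel : ∀ {a b a' b' : Ob F}, Pre F a b → Pre F a' b' → Prop
  | refl {a b : Ob F} (f : Pre F a b) : Rel f f
  | symm {a b a' b' : Ob F} {f : Pre F a b} {f' : Pre F a' b'} : Rel f f' → Rel f' f
  | trans {a b a' b' a'' b'' : Ob F} {f : Pre F a b} {f' : Pre F a' b'} {f'' : Pre F a'' b''} :
      Rel f f' → Rel f' f'' → Rel f f''
  | comp_congr {a b c a' b' c' : Ob F} {f : Pre F a b} {g : Pre F b c} {f' : Pre F a' b'}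
      {g' : Pre F b' c'} : Rel f f' → Rel g g' → Rel (f.comp g) (f'.comp g')
  | add_congr {a b c d a' b' c' d' : Ob F} {f : Pre F a b} {g : Pre F c d} {f' : Pre F a' b'}
      {g' : Pre F c' d'} : Rel f f' → Rel g g' → Rel (f.add g) (f'.add g')
  | id_comp {a b : Ob F} (f : Pre F a b) : Rel ((Pre.id a).comp f) f
  | comp_id {a b : Ob F} (f : Pre F a b) : Rel (f.comp (Pre.id b)) f
  | assoc {a b c d : Ob F} (f : Pre F a b) (g : Pre F b c) (h : Pre F c d) :
      Rel ((f.comp g).comp h) (f.comp (g.comp h))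
  | add_id (a b : Ob F) : Rel ((Pre.id a).add (Pre.id b)) (Pre.id (a + b))
  | interchange {a₁ b₁ c₁ a₂ b₂ c₂ : Ob F} (f₁ : Pre F a₁ b₁) (g₁ : Pre F b₁ c₁)
      (f₂ : Pre F a₂ b₂) (g₂ : Pre F b₂ c₂) :
      Rel ((f₁.comp g₁).add (f₂.comp g₂)) ((f₁.add f₂).comp (g₁.add g₂))
  | add_assoc {a₁ b₁ a₂ b₂ a₃ b₃ : Ob F} (f₁ : Pre F a₁ b₁) (f₂ : Pre F a₂ b₂)
      (f₃ : Pre F a₃ b₃) : Rel ((f₁.add f₂).add f₃) (f₁.add (f₂.add f₃))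
  | add_comm {a₁ b₁ a₂ b₂ : Ob F} (f₁ : Pre F a₁ b₁) (f₂ : Pre F a₂ b₂) :
      Rel (f₁.add f₂) (f₂.add f₁)
  | add_zero {a b : Ob F} (f : Pre F a b) : Rel (f.add (Pre.id 0)) f
  | of_id (j : J) (a : (F.obj j).Obj) : Rel (Pre.of j ((F.obj j).id a)) (Pre.id (ιObj F j a))
  | of_comp (j : J) {a b c : (F.obj j).Obj} (f : (F.obj j).Hom a b) (g : (F.obj j).Hom b c) :
      Rel (Pre.of j ((F.obj j).comp f g)) ((Pre.of j f).comp (Pre.of j g))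
  | of_add (j : J) {a b a' b' : (F.obj j).Obj} (f : (F.obj j).Hom a b)
      (g : (F.obj j).Hom a' b') :
      Rel (Pre.of j ((F.obj j).add f g)) ((Pre.of j f).add (Pre.of j g))
  | of_map {j k : J} (u : j ⟶ k) {a b : (F.obj j).Obj} (f : (F.obj j).Hom a b) :
      Rel (Pre.of k (mapHom F u f)) (Pre.of j f)

variable {F}

theorem Rel.endpoints {a b a' b' : Ob F} {f : Pre F a b} {f' : Pre F a' b'} (h : Rel F f f') :
    a = a' ∧ b = b' := by
  induction h with
  | refl | id_comp | comp_id | assoc | add_id | interchange | of_id | of_comp => exact ⟨rfl, rfl⟩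
  | symm _ ih => exact ⟨ih.1.symm, ih.2.symm⟩
  | trans _ _ ih ih' => exact ⟨ih.1.trans ih'.1, ih.2.trans ih'.2⟩
  | comp_congr _ _ ih ih' => exact ⟨ih.1, ih'.2⟩
  | add_congr _ _ ih ih' => exact ⟨by rw [ih.1, ih'.1], by rw [ih.2, ih'.2]⟩
  | add_assoc => exact ⟨_root_.add_assoc _ _ _, _root_.add_assoc _ _ _⟩
  | add_comm => exact ⟨_root_.add_comm _ _, _root_.add_comm _ _⟩
  | add_zero => exact ⟨_root_.add_zero _, _root_.add_zero _⟩
  | of_add j => exact ⟨map_add (ιObj F j) _ _, map_add (ιObj F j) _ _⟩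
  | of_map u => exact ⟨ιObj_map F u _, ιObj_map F u _⟩

variable (F) in
/-- The morphisms of the colimit. -/
def Mor (a b : Ob F) : Type u := Quot fun f g : Pre F a b => Rel F f g

/-- The morphism represented by a formal expression. -/
def mk {a b : Ob F} (f : Pre F a b) : Mor F a b := Quot.mk _ f

theorem mk_heq {a b a' b' : Ob F} {f : Pre F a b} {f' : Pre F a' b'} (h : Rel F f f') :
    HEq (mk f) (mk f') := by
  obtain ⟨rfl, rfl⟩ := h.endpoints
  exact heq_of_eq (Quot.sound h)

theorem mk_eq {a b : Ob F} {f f' : Pre F a b} (h : Rel F f f') : mk f = mk f' :=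
  Quot.sound h

variable (F) in
/-- The colimit of a diagram of commutative monoidal categories. -/
def colim : CMC.{u} where
  Obj := Ob F
  Hom := Mor F
  id a := mk (Pre.id a)
  comp := Quot.map₂ Pre.comp (fun f _ _ h => .comp_congr (.refl f) h)
    (fun _ _ g h => .comp_congr h (.refl g))
  add := Quot.map₂ Pre.add (fun f _ _ h => .add_congr (.refl f) h)
    (fun _ _ g h => .add_congr h (.refl g))
  id_comp := by rintro a b ⟨f⟩; exact mk_eq (.id_comp f)
  comp_id := by rintro a b ⟨f⟩; exact mk_eq (.comp_id f)
  assoc := by rintro a b c d ⟨f⟩ ⟨g⟩ ⟨h⟩; exact mk_eq (.assoc f g h)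
  add_id a b := mk_eq (.add_id a b)
  interchange := by
    rintro a₁ b₁ c₁ a₂ b₂ c₂ ⟨f₁⟩ ⟨g₁⟩ ⟨f₂⟩ ⟨g₂⟩; exact mk_eq (.interchange f₁ g₁ f₂ g₂)
  add_assoc := by
    rintro a₁ b₁ a₂ b₂ a₃ b₃ ⟨f₁⟩ ⟨f₂⟩ ⟨f₃⟩; exact mk_heq (.add_assoc f₁ f₂ f₃)
  add_comm := by rintro a₁ b₁ a₂ b₂ ⟨f₁⟩ ⟨f₂⟩; exact mk_heq (.add_comm f₁ f₂)
  add_zero := by rintro a b ⟨f⟩; exact mk_heq (.add_zero f)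

variable (F) in
/-- The inclusion of a member of the diagram into the colimit. -/
def ι (j : J) : CMCHom (F.obj j) (colim F) where
  f₀ := ιObj F j
  f₁ _ _ f := mk (Pre.of j f)
  map_id a := mk_eq (.of_id j a)
  map_comp f g := mk_eq (.of_comp j f g)
  map_add f g := mk_heq (.of_add j f g)

variable (F) in
/-- The colimit cocone. -/
def cocone : Limits.Cocone F where
  pt := colim F
  ι :=
    { app := ι F
      naturality := fun _ _ u => CMCHom.ext_hom (AddMonoidHom.ext fun a => ιObj_map F u a)
        fun _ _ f => mk_heq (.of_map u f) }

section Desc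

variable (s : Limits.Cocone F)

/-- The components of a cocone as strict monoidal functors. -/
abbrev leg (j : J) : CMCHom (F.obj j) s.pt := s.ι.app j

/-- The map on objects out of the colimit. -/
def coconeObj : Ob F →+ s.pt.Obj :=
  descObj F (fun j => (leg s j).f₀) fun u a => CMCHom.congr_f₀ (s.w u) a

theorem coconeObj_ι (j : J) (a : (F.obj j).Obj) :
    coconeObj s (ιObj F j a) = (leg s j).f₀ a :=
  descObj_ι F _ (fun u a => CMCHom.congr_f₀ (s.w u) a) j a

/-- Transport of a morphism along equalities of its endpoints. -/
def castHom (D : CMC.{u}) {a b a' b' : D.Obj} (ha : a = a') (hb : b = b') (f : D.Hom a b) :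
    D.Hom a' b' :=
  cast (by rw [ha, hb]) f

theorem castHom_heq (D : CMC.{u}) {a b a' b' : D.Obj} (ha : a = a') (hb : b = b')
    (f : D.Hom a b) : HEq (castHom D ha hb f) f :=
  cast_heq _ f

/-- The interpretation of formal expressions in the point of a cocone. -/
def eval : ∀ {a b : Ob F}, Pre F a b → s.pt.Hom (coconeObj s a) (coconeObj s b)
  | _, _, .of j f =>
      castHom s.pt (coconeObj_ι s j _).symm (coconeObj_ι s j _).symm ((leg s j).f₁ _ _ f)
  | _, _, .id a => s.pt.id (coconeObj s a)
  | _, _, .comp f g => s.pt.comp (eval f) (eval g)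
  | _, _, .add f g =>
      castHom s.pt (map_add (coconeObj s) _ _).symm (map_add (coconeObj s) _ _).symm
        (s.pt.add (eval f) (eval g))

theorem eval_of (j : J) {a b : (F.obj j).Obj} (f : (F.obj j).Hom a b) :
    HEq (eval s (Pre.of j f)) ((leg s j).f₁ a b f) :=
  castHom_heq _ _ _ _

theorem eval_add {a b a' b' : Ob F} (f : Pre F a b) (g : Pre F a' b') :
    HEq (eval s (f.add g)) (s.pt.add (eval s f) (eval s g)) :=
  castHom_heq _ _ _ _

theorem eval_add_hcongr {a b a' b' : Ob F} (f : Pre F a b) (g : Pre F a' b')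
    {c d c' d' : s.pt.Obj} {f' : s.pt.Hom c d} {g' : s.pt.Hom c' d'}
    (hc : coconeObj s a = c) (hd : coconeObj s b = d) (hc' : coconeObj s a' = c')
    (hd' : coconeObj s b' = d') (hf : HEq (eval s f) f') (hg : HEq (eval s g) g') :
    HEq (eval s (f.add g)) (s.pt.add f' g') :=
  (eval_add s f g).trans (s.pt.add_hcongr_s3 hc hd hc' hd' hf hg)

theorem eval_heq {a b a' b' : Ob F} {f : Pre F a b} {f' : Pre F a' b'} (h : Rel F f f') :
    HEq (eval s f) (eval s f') := by
  have hadd := fun a b => map_add (coconeObj s) a b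
  induction h with
  | refl => rfl
  | symm _ ih => exact ih.symm
  | trans _ _ ih ih' => exact ih.trans ih'
  | comp_congr h h' ih ih' =>
    exact s.pt.comp_hcongr_s3 (congrArg _ h.endpoints.1) (congrArg _ h.endpoints.2)
      (congrArg _ h'.endpoints.2) ih ih'
  | add_congr h h' ih ih' =>
    exact (eval_add_hcongr s _ _ (congrArg _ h.endpoints.1) (congrArg _ h.endpoints.2)
      (congrArg _ h'.endpoints.1) (congrArg _ h'.endpoints.2) ih ih').trans
      (eval_add s _ _).symm
  | id_comp f => exact heq_of_eq (s.pt.id_comp _)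
  | comp_id f => exact heq_of_eq (s.pt.comp_id _)
  | assoc f g h => exact heq_of_eq (s.pt.assoc _ _ _)
  | add_id a b =>
    exact (eval_add s _ _).trans ((heq_of_eq (s.pt.add_id _ _)).trans
      (s.pt.id_hcongr_s3 (hadd _ _).symm))
  | interchange f₁ g₁ f₂ g₂ =>
    exact (eval_add s _ _).trans ((heq_of_eq (s.pt.interchange _ _ _ _)).trans
      (s.pt.comp_hcongr_s3 (hadd _ _).symm (hadd _ _).symm (hadd _ _).symm
        (eval_add s _ _).symm (eval_add s _ _).symm))
  | add_assoc f₁ f₂ f₃ =>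
    exact (eval_add_hcongr s _ _ (hadd _ _) (hadd _ _) rfl rfl (eval_add s _ _) .rfl).trans
      ((s.pt.add_assoc _ _ _).trans (eval_add_hcongr s _ _ rfl rfl (hadd _ _) (hadd _ _) .rfl
        (eval_add s _ _)).symm)
  | add_comm f₁ f₂ =>
    exact (eval_add s _ _).trans ((s.pt.add_comm _ _).trans (eval_add s _ _).symm)
  | add_zero f =>
    have h0 := map_zero (coconeObj s)
    exact (eval_add_hcongr s f (.id 0) rfl rfl h0 h0 .rfl (s.pt.id_hcongr_s3 h0)).trans (s.pt.add_zero _)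
  | of_id j a =>
    exact (eval_of s j _).trans ((heq_of_eq ((leg s j).map_id a)).trans
      (s.pt.id_hcongr_s3 (coconeObj_ι s j a).symm))
  | of_comp j f g =>
    exact (eval_of s j _).trans ((heq_of_eq ((leg s j).map_comp f g)).trans
      (s.pt.comp_hcongr_s3 (coconeObj_ι s j _).symm (coconeObj_ι s j _).symm
        (coconeObj_ι s j _).symm (eval_of s j _).symm (eval_of s j _).symm))
  | of_add j f g =>
    exact (eval_of s j _).trans (((leg s j).map_add f g).trans
      (eval_add_hcongr s _ _ (coconeObj_ι s j _) (coconeObj_ι s j _) (coconeObj_ι s j _)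
        (coconeObj_ι s j _) (eval_of s j _) (eval_of s j _)).symm)
  | of_map u f =>
    exact (eval_of s _ _).trans ((CMCHom.congr_f₁ (s.w u) f).trans (eval_of s _ _).symm)

/-- The strict monoidal functor out of the colimit induced by a cocone. -/
def desc : CMCHom (colim F) s.pt where
  f₀ := coconeObj s
  f₁ _ _ := Quot.lift (eval s) fun _ _ h => eq_of_heq (eval_heq s h)
  map_id _ := rfl
  map_comp := by rintro a b c ⟨f⟩ ⟨g⟩; rfl
  map_add := by rintro a b a' b' ⟨f⟩ ⟨g⟩; exact eval_add s f g

theorem f₁_mk_heq_eval (m : CMCHom (colim F) s.pt) (h₀ : m.f₀ = coconeObj s)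
    (h₁ : ∀ (j : J) {a b : (F.obj j).Obj} (f : (F.obj j).Hom a b),
      HEq (m.f₁ _ _ ((ι F j).f₁ a b f)) ((leg s j).f₁ a b f))
    {a b : Ob F} (f : Pre F a b) : HEq (m.f₁ a b (mk f)) (eval s f) := by
  have h (a : Ob F) : m.f₀ a = coconeObj s a := DFunLike.congr_fun h₀ a
  induction f with
  | of j f => exact (h₁ j f).trans (eval_of s j f).symm
  | id a => exact (heq_of_eq (m.map_id a)).trans (s.pt.id_hcongr_s3 (h a))
  | comp f g ihf ihg =>
    exact (heq_of_eq (m.map_comp (mk f) (mk g))).trans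
      (s.pt.comp_hcongr_s3 (h _) (h _) (h _) ihf ihg)
  | add f g ihf ihg =>
    exact (m.map_add (mk f) (mk g)).trans
      (eval_add_hcongr s f g (h _).symm (h _).symm (h _).symm (h _).symm ihf.symm ihg.symm).symm

end Desc

variable (F) in
/-- The cocone `cocone F` is a colimit. -/
def isColimit : Limits.IsColimit (cocone F) where
  desc := desc
  fac s j := CMCHom.ext_hom (AddMonoidHom.ext fun a => coconeObj_ι s j a)
    fun _ _ f => eval_of s j f
  uniq s m hm := by
    have h₀ : CMCHom.f₀ m = coconeObj s := obj_hom_ext fun j a =>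
      (CMCHom.congr_f₀ (hm j) a).trans (coconeObj_ι s j a).symm
    refine CMCHom.ext_hom h₀ ?_
    rintro a b ⟨f⟩
    exact f₁_mk_heq_eval s m h₀ (fun j _ _ f => CMCHom.congr_f₁ (hm j) f) f

end CMC.Colimit

/-- The category `CMC` of commutative monoidal categories and strict
monoidal functors has all small colimits; in particular it has all finite colimits. -/
theorem cmc_hasColimits :
    Limits.HasColimits CMC.{u} ∧ Limits.HasFiniteColimits CMC.{u} := by
  have h : Limits.HasColimits CMC.{u} :=
    ⟨fun _ _ => ⟨fun F => ⟨⟨⟨CMC.Colimit.cocone F, CMC.Colimit.isColimit F⟩⟩⟩⟩⟩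
  exact ⟨h, inferInstance⟩
end

section
/- Let P be a Petri net and let m and n be markings of P. Then n is reachable from m if and only if there exists a morphism f : m → n in the free commutative monoidal category FP. -/
universe u

def PetriNet.Fires (P : PetriNet.{u}) (τ : P.T) (m n : Multiset P.S) : Prop :=
  P.src τ ≤ m ∧ n + P.src τ = m + P.tgt τ

inductive PetriNet.Reachable (P : PetriNet.{u}) : Multiset P.S → Multiset P.S → Prop
  | refl (m : Multiset P.S) : PetriNet.Reachable P m m
  | step {m m' n : Multiset P.S} (τ : P.T) :
      P.Fires τ m m' → PetriNet.Reachable P m' n → PetriNet.Reachable P m n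

namespace PetriNet

variable {P : PetriNet.{u}} {a b c : Multiset P.S}

theorem Fires.add_right {τ : P.T} (h : P.Fires τ a b) (c : Multiset P.S) :
    P.Fires τ (a + c) (b + c) :=
  ⟨h.1.trans (Multiset.le_add_right a c), by rw [add_right_comm, h.2, add_right_comm]⟩

theorem fires_src_tgt (P : PetriNet.{u}) (τ : P.T) : P.Fires τ (P.src τ) (P.tgt τ) :=
  ⟨le_rfl, add_comm _ _⟩

namespace Reachable

theorem trans (h₁ : P.Reachable a b) (h₂ : P.Reachable b c) : P.Reachable a c := by
  induction h₁ with
  | refl => exact h₂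
  | step τ hτ _ ih => exact .step τ hτ (ih h₂)

theorem add_right (h : P.Reachable a b) (c : Multiset P.S) :
    P.Reachable (a + c) (b + c) := by
  induction h with
  | refl => exact .refl _
  | step τ hτ _ ih => exact .step τ (hτ.add_right c) ih

theorem add {a' b' : Multiset P.S} (h : P.Reachable a b) (h' : P.Reachable a' b') :
    P.Reachable (a + a') (b + b') := by
  refine (h.add_right a').trans ?_
  rw [add_comm b a', add_comm b b']
  exact h'.add_right b

end Reachable

end PetriNet

theorem FreeExpr.reachable {P : PetriNet.{u}} {a b : Multiset P.S} (f : FreeExpr P a b) :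
    P.Reachable a b := by
  induction f with
  | gen τ => exact .step τ (P.fires_src_tgt τ) (.refl _)
  | id a => exact .refl a
  | comp _ _ ihf ihg => exact ihf.trans ihg
  | add _ _ ihf ihg => exact ihf.add ihg

/-- A firing of `τ` gives the morphism `τ + 1_c`, where `c` is the part of the marking that
`τ` does not consume. -/
theorem PetriNet.Fires.nonempty_freeHom {P : PetriNet.{u}} {τ : P.T} {a b : Multiset P.S}
    (h : P.Fires τ a b) : Nonempty (FreeHom P a b) := by
  obtain ⟨hle, heq⟩ := h
  obtain ⟨c, rfl⟩ := Multiset.le_iff_exists_add.mp hle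
  obtain rfl : b = P.tgt τ + c := by
    apply add_right_cancel (b := P.src τ)
    rw [heq, add_right_comm, add_comm (P.src τ), add_right_comm]
  exact ⟨(FreeHom.gen P τ).add (FreeHom.id P c)⟩

/-- For markings `m, n` of a Petri net `P`, the marking `n` is reachable
from `m` if and only if there is a morphism `f : m → n` in the free commutative monoidal
category `FP`. -/
theorem reachable_iff_freeHom (P : PetriNet.{u}) (m n : Multiset P.S) :
    P.Reachable m n ↔ Nonempty (FreeHom P m n) := by
  constructor
  · intro h
    induction h with
    | refl m => exact ⟨FreeHom.id P m⟩
    | step τ hτ _ ih =>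
      obtain ⟨f⟩ := hτ.nonempty_freeHom
      obtain ⟨g⟩ := ih
      exact ⟨f.comp g⟩
  · rintro ⟨f⟩
    induction f using Quot.ind with
    | _ f => exact f.reachable
end

section
/- Let P be a Petri net and let f : m → n be a morphism in the free commutative monoidal category FP. Then there exist k ≥ 0, transitions τ₁, …, τ_k of P and markings a₁, …, a_k such that f factors as the composite (τ_k + 1_{a_k}) ∘ ⋯ ∘ (τ₁ + 1_{a₁}), where each factor τ_i + 1_{a_i} : s(τ_i) + a_i → t(τ_i) + a_i is the sum of the generating morphism τ_i with an identity morphism, and the empty composite (k = 0) is the identity 1_m. -/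
universe u

/-- The predicate on morphisms of `FP` of being a composite
`(τ_k + 1_{a_k}) ∘ ⋯ ∘ (τ₁ + 1_{a₁})` of sums of a generating morphism with an identity
morphism, the empty composite (`k = 0`) being an identity morphism. -/
inductive IsFiringComposite (P : PetriNet.{u}) :
    ∀ {m n : Multiset P.S}, FreeHom P m n → Prop
  | nil (m : Multiset P.S) : IsFiringComposite P (FreeHom.id P m)
  | cons {n : Multiset P.S} (τ : P.T) (a : Multiset P.S)
      (rest : FreeHom P (P.tgt τ + a) n) : IsFiringComposite P rest →
      IsFiringComposite P
        (FreeHom.comp (FreeHom.add (FreeHom.gen P τ) (FreeHom.id P a)) rest)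

namespace IsFiringComposite

variable {P : PetriNet.{u}}

/-- Being a firing composite is invariant under the congruence on expressions, also when the
endpoints agree only propositionally. -/
theorem of_freeRel {m n m' n' : Multiset P.S} {e : FreeExpr P m n} {e' : FreeExpr P m' n'}
    (h : FreeRel P e e') (hm : m = m') (hn : n = n')
    (he : IsFiringComposite P (Quot.mk _ e : FreeHom P m n)) :
    IsFiringComposite P (Quot.mk _ e' : FreeHom P m' n') := by
  subst hm hn
  have hq : (Quot.mk _ e' : FreeHom P m n) = Quot.mk _ e := Quot.sound h.symm
  rw [hq]
  exact he

/-- Precomposing a firing composite with an expression congruent to `τ + 1_a` gives a firing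
composite. -/
theorem cons_of_freeRel {x y n : Multiset P.S} {τ : P.T} {a : Multiset P.S}
    {g : FreeExpr P x y} (h : FreeRel P g ((FreeExpr.gen τ).add (FreeExpr.id a)))
    (hx : x = P.src τ + a) (hy : y = P.tgt τ + a) {r : FreeExpr P y n}
    (hr : IsFiringComposite P (Quot.mk _ r : FreeHom P y n)) :
    IsFiringComposite P (Quot.mk _ (g.comp r) : FreeHom P x n) := by
  subst hx hy
  exact of_freeRel (.comp_congr h.symm (.refl r)) rfl rfl (cons τ a _ hr)

theorem comp {a b c : Multiset P.S} {f : FreeHom P a b} {g : FreeHom P b c}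
    (hf : IsFiringComposite P f) (hg : IsFiringComposite P g) :
    IsFiringComposite P (f.comp g) := by
  induction hf with
  | nil m =>
    induction g using Quot.ind with
    | _ g => exact of_freeRel (FreeRel.id_comp g).symm rfl rfl hg
  | cons τ d rest _ ih =>
    have hrest := ih hg
    induction rest using Quot.ind with
    | _ r =>
      induction g using Quot.ind with
      | _ g =>
        exact of_freeRel (FreeRel.assoc ((FreeExpr.gen τ).add (FreeExpr.id d)) r g).symm rfl rfl
          (cons τ d _ hrest)

theorem add_id {m n : Multiset P.S} {f : FreeHom P m n} (hf : IsFiringComposite P f)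
    (c : Multiset P.S) : IsFiringComposite P (f.add (FreeHom.id P c)) := by
  induction hf with
  | nil m => exact of_freeRel (FreeRel.add_id m c).symm rfl rfl (nil (m + c))
  | cons τ d rest _ ih =>
    induction rest using Quot.ind with
    | _ r =>
      have hassoc : FreeRel P (((FreeExpr.gen τ).add (FreeExpr.id d)).add (FreeExpr.id c))
          ((FreeExpr.gen τ).add (FreeExpr.id (d + c))) :=
        (FreeRel.add_assoc _ _ _).trans (.add_congr (.refl _) (.add_id d c))
      have hinter : FreeRel P
          ((((FreeExpr.gen τ).add (FreeExpr.id d)).add (FreeExpr.id c)).comp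
            (r.add (FreeExpr.id c)))
          ((((FreeExpr.gen τ).add (FreeExpr.id d)).comp r).add (FreeExpr.id c)) :=
        (FreeRel.interchange _ _ _ _).symm.trans (.add_congr (.refl _) (.id_comp _))
      exact of_freeRel hinter rfl rfl
        (cons_of_freeRel hassoc (_root_.add_assoc _ _ _) (_root_.add_assoc _ _ _) ih)

theorem gen (τ : P.T) : IsFiringComposite P (FreeHom.gen P τ) :=
  of_freeRel (FreeRel.comp_id (FreeExpr.gen τ)) rfl rfl
    (cons_of_freeRel (FreeRel.add_zero (FreeExpr.gen τ)).symm (_root_.add_zero _).symm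
      (_root_.add_zero _).symm (nil (P.tgt τ)))

theorem add {a b a' b' : Multiset P.S} {f : FreeHom P a b} {g : FreeHom P a' b'}
    (hf : IsFiringComposite P f) (hg : IsFiringComposite P g) :
    IsFiringComposite P (f.add g) := by
  have hf' := hf.add_id a'
  have hg' := hg.add_id b
  induction f using Quot.ind with
  | _ f =>
    induction g using Quot.ind with
    | _ g =>
      have hid := of_freeRel (FreeRel.add_comm g (FreeExpr.id b)) (_root_.add_comm _ _)
        (_root_.add_comm _ _) hg'
      exact of_freeRel ((FreeRel.interchange f (FreeExpr.id b) (FreeExpr.id a') g).symm.trans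
        (.add_congr (.comp_id f) (.id_comp g))) rfl rfl (hf'.comp hid)

end IsFiringComposite

/-- Every morphism `f : m → n` of the free commutative monoidal category
`FP` factors as a composite `(τ_k + 1_{a_k}) ∘ ⋯ ∘ (τ₁ + 1_{a₁})` of sums of generating
morphisms with identities (the empty composite being the identity `1_m`). -/
theorem freeHom_firing_factorization (P : PetriNet.{u}) {m n : Multiset P.S}
    (f : FreeHom P m n) : IsFiringComposite P f := by
  induction f using Quot.ind with
  | _ e =>
    induction e with
    | gen τ => exact .gen τ
    | id a => exact .nil a
    | comp _ _ hf hg => exact hf.comp hg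
    | add _ _ hf hg => exact hf.add hg
end

section
/- Let P : X ↛ Y and P' : X' ↛ Y' be open Petri nets with boundary legs i : X → S, o : Y → S and i' : X' → S', o' : Y' → S' respectively. Suppose (f_T, f_S) : P → P' is a morphism of the underlying Petri nets and f : X → X', g : Y → Y' are functions satisfying f_S ∘ i = i' ∘ f and f_S ∘ o = o' ∘ g. Then for every (x, y) ∈ ■P we have (ℕ[f](x), ℕ[g](y)) ∈ ■P'; that is, (ℕ[f] × ℕ[g])(■P) ⊆ ■P'. -/
universe u

/-- An open Petri net `P : X ↛ Y`: a Petri net together with functions from `X` and `Y`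
into its set of places. -/
structure OpenPetri (X Y : Type u) : Type (u + 1) where
  net : PetriNet.{u}
  i : X → net.S
  o : Y → net.S

/-- The reachability relation `■P ⊆ ℕ[X] × ℕ[Y]` of an open Petri net. -/
def OpenPetri.bsq {X Y : Type u} (P : OpenPetri X Y) : Set (Multiset X × Multiset Y) :=
  {p | P.net.Reachable (p.1.map P.i) (p.2.map P.o)}

theorem PetriNet.Fires.map {P Q : PetriNet.{u}} (φ : PetriHom P Q) {τ : P.T}
    {m n : Multiset P.S} (h : P.Fires τ m n) : Q.Fires (φ.f τ) (m.map φ.g) (n.map φ.g) := by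
  refine ⟨φ.hs τ ▸ Multiset.map_le_map h.1, ?_⟩
  rw [← φ.hs, ← φ.ht, ← Multiset.map_add, ← Multiset.map_add, h.2]

theorem PetriNet.Reachable.map {P Q : PetriNet.{u}} (φ : PetriHom P Q)
    {m n : Multiset P.S} (h : P.Reachable m n) : Q.Reachable (m.map φ.g) (n.map φ.g) := by
  induction h with
  | refl m => exact .refl _
  | step τ hτ _ ih => exact .step (φ.f τ) (hτ.map φ) ih

/-- Given a morphism of open Petri nets — a morphism `(f_T, f_S)` of the
underlying Petri nets together with functions `f : X → X'`, `g : Y → Y'` commuting with the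
boundary legs — the reachability relations satisfy `(ℕ[f] × ℕ[g])(■P) ⊆ ■P'`. -/
theorem bsq_map {X Y X' Y' : Type u} (P : OpenPetri X Y) (P' : OpenPetri X' Y')
    (φ : PetriHom P.net P'.net) (f : X → X') (g : Y → Y')
    (hi : ∀ x : X, φ.g (P.i x) = P'.i (f x))
    (ho : ∀ y : Y, φ.g (P.o y) = P'.o (g y)) :
    ∀ x : Multiset X, ∀ y : Multiset Y,
      (x, y) ∈ P.bsq → (x.map f, y.map g) ∈ P'.bsq := by
  intro x y h
  have h' := PetriNet.Reachable.map φ h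
  simpa only [OpenPetri.bsq, Set.mem_ofPred_eq, Multiset.map_map, Function.comp_def, hi, ho]
    using h'
end
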